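/- Let p be an odd prime, F_p ⊆ F_s ⊆ F_t ⊆ F_{t²} finite fields, and N ≥ 1. For a quadratic hermitian form f on F_t^{2N} and v ∈ F_t^{2N} with (f, v) ≠ (0, 0), let M(f,v) be the number of x ∈ F_t^{2N} with Tr_{F_t/F_s}(f(x) + v·x) = 0. Then (1/s)(t^{2N} − (s−1)t^{2N−1}) ≤ M(f,v) ≤ (1/s)(t^{2N} + t^{2N−1}). Equivalently, the Hamming weight w(γ(f,v)) = t^{2N} − M(f,v) of the codeword γ(f,v) = (Tr_{F_t/F_s}(f(x)+v·x))_{x ∈ F_t^{2N}} satisfies t^{2N} − (1/s)(t^{2N} + t^{2N−1}) ≤ w(γ(f,v)) ≤ t^{2N} − (1/s)(t^{2N} − (s−1)t^{2N−1}). -/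

import Mathlib

/-- `H` is a sesquilinear hermitian form on `F_{t²}^N` (conjugation is `x ↦ x^t`). -/
def IsSesquiHermitian {K : Type} [Field K] {N : ℕ} (t : ℕ)
    (H : (Fin N → K) → (Fin N → K) → K) : Prop :=
  (∀ x x' y, H (x + x') y = H x y + H x' y) ∧
  (∀ x y y', H x (y + y') = H x y + H x y') ∧
  (∀ (c : K) (x y : Fin N → K), H (c • x) y = c ^ t * H x y) ∧
  (∀ (c : K) (x y : Fin N → K), H x (c • y) = c * H x y) ∧
  (∀ x y, H x y = H y x ^ t)

/-- The `F_t`-isomorphism `ι : F_t^{2N} → F_{t²}^N`,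
`ι(x₁,…,x₂ₙ) = (x₁ + α x₂, …, x₂ₙ₋₁ + α x₂ₙ)`. -/
def iota (N : ℕ) (F K : Type) [Field F] [Field K] [Algebra F K] (α : K)
    (x : Fin (2 * N) → F) : Fin N → K :=
  fun i => algebraMap F K (x ⟨2 * i.1, by have := i.isLt; omega⟩) +
    algebraMap F K (x ⟨2 * i.1 + 1, by have := i.isLt; omega⟩) * α

open Finset in
theorem aux_addfiber {G M : Type} [AddGroup G] [Fintype G] [AddGroup M] [Fintype M] [DecidableEq M]
    (f : G →+ M) (hf : Function.Surjective f) (h : M) :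
    Fintype.card M * #{g | f g = h} = Fintype.card G := by
  have h1 : Fintype.card G = ∑ m : M, #{g | f g = m} := by
    rw [← Finset.card_univ]
    exact Finset.card_eq_sum_card_fiberwise (fun _ _ => Finset.mem_coe.2 (Finset.mem_univ _))
  rw [h1, Finset.sum_congr rfl (fun m _ =>
    AddMonoidHom.card_fiber_eq_of_mem_range f (hf m) (hf h))]
  simp

open Finset in
theorem aux_normfiber {F K : Type} [Field F] [Field K] [Fintype F] [Fintype K] [DecidableEq F]
    [Algebra F K] (hcK : Fintype.card K = Fintype.card F ^ 2) (u : F) (hu : u ≠ 0) :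
    #{z : K | Algebra.norm F z = u} = Fintype.card F + 1 := by
  have h1 : Fintype.card K = ∑ m : F, #{g : K | Algebra.norm F g = m} := by
    rw [← Finset.card_univ]
    exact Finset.card_eq_sum_card_fiberwise (fun _ _ => Finset.mem_coe.2 (Finset.mem_univ _))
  have h2 : ∀ m : F, m ≠ 0 →
      #{g : K | Algebra.norm F g = m} = #{z : K | Algebra.norm F z = u} := by
    intro m hm
    obtain ⟨w, hw⟩ := FiniteField.norm_surjective F K (u / m)
    have hw0 : w ≠ 0 := by
      rintro rfl
      rw [Algebra.norm_zero] at hw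
      exact div_ne_zero hu hm hw.symm
    refine Finset.card_equiv (Equiv.mulRight₀ w hw0) ?_
    intro z
    simp only [Finset.mem_filter, Finset.mem_univ, true_and]
    change _ ↔ Algebra.norm F (z * w) = u
    rw [map_mul, hw]
    constructor
    · rintro h
      rw [h]; field_simp
    · intro h
      field_simp at h
      exact h
  have h3 : #{g : K | Algebra.norm F g = 0} = 1 := by
    rw [Finset.card_eq_one]
    refine ⟨0, ?_⟩
    ext z
    simp [Algebra.norm_eq_zero_iff]
  rw [← Finset.add_sum_erase _ _ (Finset.mem_univ (0 : F)), h3,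
    Finset.sum_congr rfl (fun m hm => h2 m (Finset.ne_of_mem_erase hm)), hcK] at h1
  simp only [sum_const, Finset.card_erase_of_mem (Finset.mem_univ _), Finset.card_univ,
    smul_eq_mul] at h1
  have h4 := Fintype.one_lt_card (α := F)
  obtain ⟨k, hk⟩ : ∃ k, Fintype.card F = k + 2 := ⟨Fintype.card F - 2, by omega⟩
  rw [hk] at h1 ⊢
  have h5 : (k + 1) * #{z : K | Algebra.norm F z = u} = (k + 1) * (k + 2 + 1) := by
    have : k + 2 - 1 = k + 1 := rfl
    rw [this] at h1
    nlinarith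
  exact Nat.eq_of_mul_eq_mul_left (Nat.succ_pos k) h5

open Finset in
/-- Number of `z` in `K` with `Tr (a N z) = τ`. -/
theorem aux_line {E F K : Type} [Field E] [Field F] [Field K] [Fintype E] [Fintype F] [Fintype K]
    [DecidableEq E] [DecidableEq F] [Algebra E F]
    [Algebra F K] (hcK : Fintype.card K = Fintype.card F ^ 2) (a : F) (ha : a ≠ 0) (τ : E) :
    Fintype.card E * (#{z : K | Algebra.trace E F (a * Algebra.norm F z) = τ}
      + (if τ = 0 then Fintype.card F else 0)) = Fintype.card F ^ 2 + Fintype.card F := by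
  have h1 : #{z : K | Algebra.trace E F (a * Algebra.norm F z) = τ} =
      ∑ m : F, if Algebra.trace E F (a * m) = τ then #{g : K | Algebra.norm F g = m} else 0 := by
    rw [Finset.card_eq_sum_card_fiberwise (f := fun z : K => Algebra.norm F z) (t := Finset.univ)
      (fun _ _ => Finset.mem_coe.2 (Finset.mem_univ _))]
    refine Finset.sum_congr rfl fun m _ => ?_
    split_ifs with h
    · congr 1
      ext z
      simp only [Finset.mem_filter, Finset.mem_univ, true_and]
      constructor
      · exact fun h => h.2
      · rintro rfl; exact ⟨h, rfl⟩
    · rw [Finset.card_eq_zero]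
      ext z
      simp only [Finset.mem_filter, Finset.mem_univ, true_and, Finset.notMem_empty, iff_false]
      rintro ⟨h1, rfl⟩; exact h h1
  have h3 : #{g : K | Algebra.norm F g = 0} = 1 := by
    rw [Finset.card_eq_one]
    refine ⟨0, ?_⟩
    ext z
    simp [Algebra.norm_eq_zero_iff]
  have hz : (if τ = 0 then Fintype.card F else 0) =
      ∑ m : F, if m = 0 then (if τ = 0 then Fintype.card F else 0) else 0 := by simp
  let φ : F →+ E := (Algebra.trace E F).toAddMonoidHom.comp (AddMonoidHom.mulLeft a)
  have hφ : ∀ m, φ m = Algebra.trace E F (a * m) := fun m => rfl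
  have hsurj : Function.Surjective φ := by
    intro e
    obtain ⟨y, hy⟩ := Algebra.trace_surjective E F e
    refine ⟨a⁻¹ * y, ?_⟩
    rw [hφ, mul_inv_cancel_left₀ ha, hy]
  have h4 := aux_addfiber φ hsurj τ
  have h5 : #{z : K | Algebra.trace E F (a * Algebra.norm F z) = τ}
      + (if τ = 0 then Fintype.card F else 0) =
      (Fintype.card F + 1) * #{m : F | φ m = τ} := by
    rw [h1, hz, ← Finset.sum_add_distrib, Finset.card_filter, Finset.mul_sum]
    refine Finset.sum_congr rfl fun m _ => ?_
    rw [hφ]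
    by_cases hm : m = 0
    · subst hm
      rw [h3]
      by_cases ht : τ = 0
      · simp [ht, add_comm]
      · simp [ht, Ne.symm ht]
    · rw [aux_normfiber hcK m hm]
      simp [hm]
  rw [h5, Nat.mul_left_comm, h4]
  ring

/-- Completing the square on a line. -/
theorem aux_square {F K : Type} [Field F] [Field K] [Fintype F] [Fintype K]
    [Algebra F K] (hcK : Fintype.card K = Fintype.card F ^ 2) (a : F) (ha : a ≠ 0)
    (b : K) (l : K →ₗ[F] F) :
    ∃ (w : K) (k : F), ∀ z : K, algebraMap F K a * z ^ (Fintype.card F + 1) + z * b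
      + (z * b) ^ (Fintype.card F) + algebraMap F K (l z) =
      algebraMap F K (a * Algebra.norm F (z + w) + k) := by
  have hr : Module.finrank F K = 2 := by
    have := Module.card_eq_pow_finrank (K := F) (V := K)
    rw [hcK] at this
    exact (Nat.pow_right_injective Fintype.one_lt_card this).symm
  have htr : ∀ z : K, algebraMap F K (Algebra.trace F K z) = z + z ^ Fintype.card F := by
    intro z
    rw [FiniteField.algebraMap_trace_eq_sum_pow, hr]
    simp [Finset.sum_range_succ]
  have hnm : ∀ z : K, algebraMap F K (Algebra.norm F z) = z * z ^ Fintype.card F := by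
    intro z
    rw [FiniteField.algebraMap_norm_eq_prod_pow, hr]
    simp [Finset.prod_range_succ]
  have hadd : ∀ x y : K, (x + y) ^ Fintype.card F = x ^ Fintype.card F + y ^ Fintype.card F := by
    intro x y
    exact map_add (FiniteField.frobeniusAlgHom F K) x y
  have hF : ∀ c : F, (algebraMap F K c) ^ Fintype.card F = algebraMap F K c := by
    intro c
    rw [← map_pow, FiniteField.pow_card]
  have hK : ∀ c : K, (c ^ Fintype.card F) ^ Fintype.card F = c := by
    intro c
    rw [← pow_mul, ← pow_two, ← hcK, FiniteField.pow_card]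
  have hnd := traceForm_nondegenerate F K
  set β := ((Algebra.traceForm F K).toDual hnd).symm l with hβ
  have hl : ∀ z, Algebra.trace F K (β * z) = l z := by
    intro z
    have := LinearMap.BilinForm.apply_toDual_symm_apply (hB := hnd) l z
    rwa [Algebra.traceForm_apply] at this
  have ha' : algebraMap F K a ≠ 0 := by simpa using ha
  set c := (b + β) / algebraMap F K a with hc
  have hc' : b = algebraMap F K a * c - β := by rw [hc]; field_simp; ring
  have hcard : Fintype.card F ≠ 0 := Fintype.card_ne_zero
  refine ⟨c ^ Fintype.card F, - (a * Algebra.norm F c), fun z => ?_⟩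
  rw [← hl, htr, map_add, map_mul, hnm, hadd, hK, map_neg, map_mul, hnm]
  have hb : b ^ Fintype.card F = algebraMap F K a * c ^ Fintype.card F - β ^ Fintype.card F := by
    have h : b + β = algebraMap F K a * c := by rw [hc']; ring
    have := hadd b β
    rw [h, mul_pow, hF] at this
    rw [this]; ring
  rw [mul_pow, mul_pow, hb, pow_succ]
  rw [hc']
  ring

theorem aux_iota (N : ℕ) (F K : Type) [Field F] [Field K] [Fintype F] [Fintype K]
    [Algebra F K] (hcK : Fintype.card K = Fintype.card F ^ 2) (α : K)
    (hα : Algebra.adjoin F ({α} : Set K) = ⊤) :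
    ∃ E : (Fin (2 * N) → F) ≃ₗ[F] (Fin N → K), ∀ x, E x = iota N F K α x := by
  classical
  let L : (Fin (2 * N) → F) →ₗ[F] (Fin N → K) :=
    { toFun := iota N F K α
      map_add' := by
        intro x y
        ext i
        simp only [iota, Pi.add_apply, map_add]
        ring
      map_smul' := by
        intro c x
        ext i
        simp only [iota, Pi.smul_apply, smul_eq_mul, map_mul, RingHom.id_apply, Algebra.smul_def]
        ring }
  have hαF : ∀ c : F, algebraMap F K c ≠ α := by
    intro c hc
    have h1 : Algebra.adjoin F ({α} : Set K) = ⊥ := by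
      rw [eq_bot_iff, Algebra.adjoin_le_iff]
      rintro x rfl
      exact Algebra.mem_bot.2 ⟨c, hc⟩
    rw [h1] at hα
    have hs : Function.Surjective (algebraMap F K) := by
      intro y
      have : y ∈ (⊥ : Subalgebra F K) := by rw [hα]; trivial
      exact Algebra.mem_bot.1 this
    have h2 := Fintype.card_le_of_surjective _ hs
    have h3 := Fintype.one_lt_card (α := F)
    rw [hcK] at h2
    nlinarith
  have hab : ∀ a b : F, algebraMap F K a + algebraMap F K b * α = 0 → a = 0 ∧ b = 0 := by
    intro a b h
    by_cases hb : b = 0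
    · subst hb
      simpa using h
    · exfalso
      apply hαF (-a / b)
      have hb' : algebraMap F K b ≠ 0 := by simpa using hb
      rw [map_div₀, map_neg]
      field_simp
      linear_combination -h
  have hinj : Function.Injective L := by
    rw [← LinearMap.ker_eq_bot, LinearMap.ker_eq_bot']
    intro x hx
    ext j
    have hj := j.isLt
    have h := congrFun hx ⟨j.1 / 2, by omega⟩
    have h' := hab _ _ h
    rcases Nat.mod_two_eq_zero_or_one j.1 with h0 | h0
    · rw [Pi.zero_apply, ← h'.1]
      congr 1
      ext
      simp only
      omega
    · rw [Pi.zero_apply, ← h'.2]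
      congr 1
      ext
      simp only
      omega
  have hcard : Fintype.card (Fin (2 * N) → F) = Fintype.card (Fin N → K) := by
    simp [hcK, pow_mul]
  exact ⟨LinearEquiv.ofBijective L ((Fintype.bijective_iff_injective_and_card L).2 ⟨hinj, hcard⟩),
    fun x => rfl⟩

open Finset in
theorem aux_avg {X K : Type} [AddGroup X] [Fintype X] [Fintype K] (P : X → Prop) [DecidablePred P]
    (m : K → X) (c s A B : ℕ)
    (h : ∀ x, s * (#{z : K | P (x + m z)} + c) ≥ A ∧ s * #{z : K | P (x + m z)} ≤ B) :
    Fintype.card X * A ≤ s * (Fintype.card K * #{x | P x} + Fintype.card X * c) ∧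
      s * (Fintype.card K * #{x | P x}) ≤ Fintype.card X * B := by
  have key : ∑ x : X, #{z : K | P (x + m z)} = Fintype.card K * #{x | P x} := by
    simp_rw [Finset.card_filter]
    rw [Finset.sum_comm]
    have hz : ∀ z : K, (∑ x : X, if P (x + m z) then 1 else 0) = ∑ x : X, if P x then 1 else 0 :=
      fun z => Equiv.sum_comp (Equiv.addRight (m z)) (fun x => if P x then 1 else 0)
    simp [hz]
  constructor
  · have h1 := Finset.sum_le_sum (fun x (_ : x ∈ Finset.univ) => (h x).1)
    rw [← Finset.mul_sum, Finset.sum_add_distrib, key] at h1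
    simpa using h1
  · have h1 := Finset.sum_le_sum (fun x (_ : x ∈ Finset.univ) => (h x).2)
    rw [← Finset.mul_sum, key] at h1
    simpa using h1

/-- For a quadratic hermitian form `f` on `F_t^{2N}` and `v ∈ F_t^{2N}` with
`(f, v) ≠ (0, 0)`, the number `M(f,v)` of solutions of `Tr_{F_t/F_s}(f(x) + v·x) = 0`
satisfies `(t^{2N} − (s−1)t^{2N−1})/s ≤ M(f,v) ≤ (t^{2N} + t^{2N−1})/s`; equivalently,
the weight of the codeword `γ(f,v)` of the code `Γ` satisfies
`t^{2N} − (t^{2N} + t^{2N−1})/s ≤ w(γ(f,v)) ≤ t^{2N} − (t^{2N} − (s−1)t^{2N−1})/s`. -/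
theorem stmt_19 (p s t N : ℕ) [Fact p.Prime] (hpodd : p ≠ 2) (hN : 1 ≤ N)
    (Fs Ft K : Type) [Field Fs] [Field Ft] [Field K]
    [Fintype Fs] [Fintype Ft] [Fintype K] [DecidableEq Fs] [DecidableEq Ft]
    [Algebra (ZMod p) Fs] [Algebra (ZMod p) Ft] [Algebra Fs Ft] [Algebra Ft K]
    [IsScalarTower (ZMod p) Fs Ft]
    (hcs : Fintype.card Fs = s) (hct : Fintype.card Ft = t)
    (hcK : Fintype.card K = t ^ 2)
    (H : (Fin N → K) → (Fin N → K) → K) (hH : IsSesquiHermitian t H)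
    (α : K) (hα : Algebra.adjoin Ft ({α} : Set K) = ⊤)
    (f : (Fin (2 * N) → Ft) → Ft)
    (hf : ∀ x, algebraMap Ft K (f x) = H (iota N Ft K α x) (iota N Ft K α x))
    (v : Fin (2 * N) → Ft)
    (hfv : ¬ (f = 0 ∧ v = 0)) :
    ((t : ℚ) ^ (2 * N) - ((s : ℚ) - 1) * (t : ℚ) ^ (2 * N - 1)) / s ≤
      (Nat.card {x : Fin (2 * N) → Ft //
        Algebra.trace Fs Ft (f x + ∑ i, v i * x i) = 0} : ℚ) ∧
    (Nat.card {x : Fin (2 * N) → Ft //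
        Algebra.trace Fs Ft (f x + ∑ i, v i * x i) = 0} : ℚ) ≤
      ((t : ℚ) ^ (2 * N) + (t : ℚ) ^ (2 * N - 1)) / s := by
  classical
  subst hcs hct
  have hs0 : (0 : ℚ) < Fintype.card Fs := by exact_mod_cast Fintype.card_pos
  have ht0 : (0 : ℚ) < Fintype.card Ft := by exact_mod_cast Fintype.card_pos
  have hX : Fintype.card (Fin (2 * N) → Ft) = Fintype.card Ft ^ (2 * N) := by simp
  rw [Nat.card_eq_fintype_card, Fintype.card_subtype]
  rw [div_le_iff₀ hs0, le_div_iff₀ hs0]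
  by_cases hf0 : f = 0
  · have hv : v ≠ 0 := fun h => hfv ⟨hf0, h⟩
    let φ : (Fin (2 * N) → Ft) →+ Fs := (Algebra.trace Fs Ft).toAddMonoidHom.comp
      { toFun := fun x => ∑ i, v i * x i
        map_zero' := by simp
        map_add' := by intro x y; simp [mul_add, Finset.sum_add_distrib] }
    have hφ : ∀ x, φ x = Algebra.trace Fs Ft (∑ i, v i * x i) := fun x => rfl
    have hsurj : Function.Surjective φ := by
      intro e
      obtain ⟨y, hy⟩ := Algebra.trace_surjective Fs Ft e
      obtain ⟨j, hj⟩ := Function.ne_iff.1 hv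
      have hj' : v j ≠ 0 := hj
      refine ⟨Pi.single j ((v j)⁻¹ * y), ?_⟩
      rw [hφ, Finset.sum_eq_single j]
      · rw [Pi.single_eq_same, mul_inv_cancel_left₀ hj', hy]
      · intro i _ hi
        rw [Pi.single_eq_of_ne hi, mul_zero]
      · simp
    have h1 := aux_addfiber φ hsurj 0
    rw [hX] at h1
    simp only [hφ] at h1
    simp only [hf0, Pi.zero_apply, zero_add]
    have h2 : (Fintype.card Fs : ℚ) * (Finset.card {x : Fin (2 * N) → Ft |
        Algebra.trace Fs Ft (∑ i, v i * x i) = 0} : ℚ) = (Fintype.card Ft : ℚ) ^ (2 * N) := by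
      exact_mod_cast h1
    have h3 : (1 : ℚ) ≤ Fintype.card Fs := by exact_mod_cast Fintype.card_pos
    have h4 : (0 : ℚ) ≤ (Fintype.card Ft : ℚ) ^ (2 * N - 1) := by positivity
    constructor <;> nlinarith
  · obtain ⟨x0, hx0⟩ := Function.ne_iff.1 hf0
    have ha : f x0 ≠ 0 := hx0
    obtain ⟨E, hE⟩ := aux_iota N Ft K hcK α hα
    obtain ⟨H1, H2, H3, H4, H5⟩ := hH
    simp only [← hE] at hf
    let m : K → (Fin (2 * N) → Ft) := fun z => E.symm (z • E x0)
    let l : K →ₗ[Ft] Ft :=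
      { toFun := fun z => ∑ i, v i * m z i
        map_add' := by
          intro x y
          simp [m, add_smul, mul_add, Finset.sum_add_distrib]
        map_smul' := by
          intro c x
          simp only [m, smul_assoc, map_smul, Pi.smul_apply, smul_eq_mul, RingHom.id_apply,
            Finset.mul_sum]
          exact Finset.sum_congr rfl fun i _ => by ring }
    have hline : ∀ x, ∃ (w : K) (k : Ft), ∀ z,
        f (x + m z) + ∑ i, v i * (x + m z) i = f x0 * Algebra.norm Ft (z + w) + k := by
      intro x
      obtain ⟨w, k, h⟩ := aux_square hcK (f x0) ha (H (E x) (E x0)) l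
      refine ⟨w, k + (f x + ∑ i, v i * x i), fun z => ?_⟩
      apply (algebraMap Ft K).injective
      have e1 : ∑ i, v i * (x + m z) i = ∑ i, v i * x i + l z := by
        simp [l, mul_add, Finset.sum_add_distrib]
      have e2 : algebraMap Ft K (f (x + m z)) = algebraMap Ft K (f x) +
          (algebraMap Ft K (f x0) * z ^ (Fintype.card Ft + 1) + z * H (E x) (E x0)
            + (z * H (E x) (E x0)) ^ Fintype.card Ft) := by
        have e3 : E (x + m z) = E x + z • E x0 := by simp [m]
        rw [hf, e3, H1, H2, H2, H3, H4, H4, H3, hf, hf, mul_pow, ← H5]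
        ring
      have := h z
      have e4 : f x0 * Algebra.norm Ft (z + w) + (k + (f x + ∑ i, v i * x i)) =
          (f x0 * Algebra.norm Ft (z + w) + k) + (f x + ∑ i, v i * x i) := by ring
      rw [e4, e1, map_add, e2, map_add, map_add _ (_ + k), ← this, map_add]
      ring
    have hcount : ∀ x, Fintype.card Fs * (Finset.card {z : K | Algebra.trace Fs Ft
          (f (x + m z) + ∑ i, v i * (x + m z) i) = 0} + Fintype.card Ft) ≥
            Fintype.card Ft ^ 2 + Fintype.card Ft ∧
        Fintype.card Fs * (Finset.card {z : K | Algebra.trace Fs Ft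
          (f (x + m z) + ∑ i, v i * (x + m z) i) = 0}) ≤
            Fintype.card Ft ^ 2 + Fintype.card Ft := by
      intro x
      obtain ⟨w, k, h⟩ := hline x
      have e : Finset.card {z : K | Algebra.trace Fs Ft
          (f (x + m z) + ∑ i, v i * (x + m z) i) = 0} =
          Finset.card {z : K | Algebra.trace Fs Ft (f x0 * Algebra.norm Ft z) =
            - Algebra.trace Fs Ft k} := by
        refine Finset.card_equiv (Equiv.addRight w) ?_
        intro z
        simp only [Finset.mem_filter, Finset.mem_univ, true_and, Equiv.coe_addRight]
        rw [h z, map_add, eq_neg_iff_add_eq_zero]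
      rw [e]
      have := aux_line (E := Fs) hcK (f x0) ha (- Algebra.trace Fs Ft k)
      split_ifs at this with h0
      · constructor
        · exact this.ge
        · nlinarith
      · constructor
        · nlinarith
        · exact this.le
    obtain ⟨q1, q2⟩ := aux_avg (fun x => Algebra.trace Fs Ft (f x + ∑ i, v i * x i) = 0)
      m _ _ _ _ hcount
    rw [hX, hcK] at q1 q2
    obtain ⟨n, rfl⟩ : ∃ n, N = n + 1 := ⟨N - 1, by omega⟩
    have e1 : 2 * (n + 1) - 1 = 2 * n + 1 := by omega
    rw [e1]
    generalize (Finset.card {x : Fin (2 * (n + 1)) → Ft |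
      Algebra.trace Fs Ft (f x + ∑ i, v i * x i) = 0}) = M at q1 q2 ⊢
    have q1' : ((Fintype.card Ft : ℚ) ^ (2 * (n + 1))) * (Fintype.card Ft ^ 2 + Fintype.card Ft) ≤
      Fintype.card Fs * (Fintype.card Ft ^ 2 * M +
        (Fintype.card Ft : ℚ) ^ (2 * (n + 1)) * Fintype.card Ft) := by exact_mod_cast q1
    have q2' : (Fintype.card Fs : ℚ) * (Fintype.card Ft ^ 2 * M) ≤
      (Fintype.card Ft : ℚ) ^ (2 * (n + 1)) * (Fintype.card Ft ^ 2 + Fintype.card Ft) := by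
      exact_mod_cast q2
    have ht2 : (0 : ℚ) < (Fintype.card Ft : ℚ) ^ 2 := by positivity
    constructor
    · refine le_of_mul_le_mul_left ?_ ht2
      have e2 : ∀ t : ℚ, t ^ (2 * (n + 1)) = t ^ (2 * n + 1) * t := fun t => by ring
      rw [e2] at *
      linarith
    · refine le_of_mul_le_mul_left ?_ ht2
      have e2 : ∀ t : ℚ, t ^ (2 * (n + 1)) = t ^ (2 * n + 1) * t := fun t => by ring
      rw [e2] at *
      linarith
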